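/- For every real t > 0 and every natural number m ≥ 1, ∫_{−∞}^{∞} x·e^{mx − t·cosh x} dx = m!·Σ_{k=0}^{m−1} [K_k(t)/(k!·(m−k))]·(t/2)^{k−m}, and ∫_{−∞}^{∞} x·e^{−mx − t·cosh x} dx = −m!·Σ_{k=0}^{m−1} [K_k(t)/(k!·(m−k))]·(t/2)^{k−m}. -/

import Mathlib

open Real MeasureTheory

/-- Modified Bessel function of the second kind (Macdonald function). -/
noncomputable def besselK (ν t : ℝ) : ℝ :=
  (1 / 2) * ∫ x : ℝ, Real.exp (ν * x - t * Real.cosh x)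

section IntegralRecurrence

lemma exp_sub_mul_cosh_le {t : ℝ} (ht : 0 < t) (ν x : ℝ) :
    exp (ν * x - t * cosh x) ≤ exp (2 * ν ^ 2 / t) * exp (-(t / 8) * x ^ 2) := by
  rw [← exp_add, exp_le_exp]
  have hcosh : x ^ 2 / 4 ≤ cosh x := by
    rw [← cosh_abs, cosh_eq]
    have h₁ := quadratic_le_exp_of_nonneg (abs_nonneg x)
    have h₂ := exp_pos (-|x|)
    have h₃ := abs_nonneg x
    rw [sq_abs] at h₁
    linarith
  have hsq : 2 * ν ^ 2 / t + t / 8 * x ^ 2 - ν * x = (4 * ν - t * x) ^ 2 / (8 * t) := by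
    field_simp
    ring
  have hnonneg : 0 ≤ (4 * ν - t * x) ^ 2 / (8 * t) := by positivity
  have := mul_le_mul_of_nonneg_left hcosh ht.le
  linarith

lemma integrable_exp_sub_mul_cosh {t : ℝ} (ht : 0 < t) (ν : ℝ) :
    Integrable fun x : ℝ => exp (ν * x - t * cosh x) := by
  refine ((integrable_exp_neg_mul_sq (b := t / 8) (by positivity)).const_mul
    (exp (2 * ν ^ 2 / t))).mono' (by fun_prop) (.of_forall fun x => ?_)
  rw [norm_of_nonneg (exp_pos _).le]
  exact exp_sub_mul_cosh_le ht ν x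

lemma integrable_id_mul_exp_sub_mul_cosh {t : ℝ} (ht : 0 < t) (ν : ℝ) :
    Integrable fun x : ℝ => x * exp (ν * x - t * cosh x) := by
  refine ((integrable_mul_exp_neg_mul_sq (b := t / 8) (by positivity)).norm.const_mul
    (exp (2 * ν ^ 2 / t))).mono' (by fun_prop) (.of_forall fun x => ?_)
  rw [norm_mul, norm_mul, norm_of_nonneg (exp_pos _).le, norm_of_nonneg (exp_pos _).le,
    mul_left_comm]
  exact mul_le_mul_of_nonneg_left (exp_sub_mul_cosh_le ht ν x) (norm_nonneg x)

lemma hasDerivAt_exp_sub_mul_cosh (ν t x : ℝ) :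
    HasDerivAt (fun x : ℝ => exp (ν * x - t * cosh x))
      (ν * exp (ν * x - t * cosh x) - t / 2 * exp ((ν + 1) * x - t * cosh x)
        + t / 2 * exp ((ν - 1) * x - t * cosh x)) x := by
  have h := (((hasDerivAt_id x).const_mul ν).sub ((hasDerivAt_cosh x).const_mul t)).exp
  refine h.congr_deriv ?_
  have h₁ : (ν + 1) * x - t * cosh x = (ν * x - t * cosh x) + x := by ring
  have h₂ : (ν - 1) * x - t * cosh x = (ν * x - t * cosh x) + -x := by ring
  rw [h₁, h₂, exp_add _ x, exp_add _ (-x), sinh_eq]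
  simp only [Pi.sub_apply, id]
  ring

lemma besselK_add_one {t : ℝ} (ht : 0 < t) (ν : ℝ) :
    besselK (ν + 1) t = besselK (ν - 1) t + ν / (t / 2) * besselK ν t := by
  have i₀ := (integrable_exp_sub_mul_cosh ht ν).const_mul ν
  have i₁ := (integrable_exp_sub_mul_cosh ht (ν + 1)).const_mul (t / 2)
  have i₂ := (integrable_exp_sub_mul_cosh ht (ν - 1)).const_mul (t / 2)
  have i₀₁ : Integrable fun x : ℝ => ν * exp (ν * x - t * cosh x)
      - t / 2 * exp ((ν + 1) * x - t * cosh x) := i₀.sub i₁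
  have h := integral_eq_zero_of_hasDerivAt_of_integrable (hasDerivAt_exp_sub_mul_cosh ν t)
    (i₀₁.fun_add i₂) (integrable_exp_sub_mul_cosh ht ν)
  rw [integral_add i₀₁ i₂, integral_sub i₀ i₁] at h
  simp only [integral_const_mul] at h
  unfold besselK
  field_simp
  linarith

lemma integral_id_mul_exp_sub_mul_cosh_add_one {t : ℝ} (ht : 0 < t) (ν : ℝ) :
    ∫ x : ℝ, x * exp ((ν + 1) * x - t * cosh x) =
      (∫ x : ℝ, x * exp ((ν - 1) * x - t * cosh x))
        + ν / (t / 2) * (∫ x : ℝ, x * exp (ν * x - t * cosh x))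
        + 2 / (t / 2) * besselK ν t := by
  have i := integrable_exp_sub_mul_cosh ht ν
  have i₀ := (integrable_id_mul_exp_sub_mul_cosh ht ν).const_mul ν
  have i₁ := (integrable_id_mul_exp_sub_mul_cosh ht (ν + 1)).const_mul (t / 2)
  have i₂ := (integrable_id_mul_exp_sub_mul_cosh ht (ν - 1)).const_mul (t / 2)
  have i₀₁ : Integrable fun x : ℝ => ν * (x * exp (ν * x - t * cosh x))
      - t / 2 * (x * exp ((ν + 1) * x - t * cosh x)) := i₀.sub i₁
  have hderiv (x : ℝ) : HasDerivAt (fun x : ℝ => x * exp (ν * x - t * cosh x))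
      (exp (ν * x - t * cosh x) + (ν * (x * exp (ν * x - t * cosh x))
        - t / 2 * (x * exp ((ν + 1) * x - t * cosh x))
        + t / 2 * (x * exp ((ν - 1) * x - t * cosh x)))) x := by
    refine ((hasDerivAt_id x).mul (hasDerivAt_exp_sub_mul_cosh ν t x)).congr_deriv ?_
    simp only [id]
    ring
  have h := integral_eq_zero_of_hasDerivAt_of_integrable hderiv
    (i.fun_add (i₀₁.fun_add i₂)) (integrable_id_mul_exp_sub_mul_cosh ht ν)
  rw [integral_add i (i₀₁.fun_add i₂), integral_add i₀₁ i₂, integral_sub i₀ i₁] at h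
  simp only [integral_const_mul] at h
  unfold besselK
  generalize (∫ x : ℝ, x * exp ((ν + 1) * x - t * cosh x)) = J₁ at h ⊢
  generalize (∫ x : ℝ, x * exp ((ν - 1) * x - t * cosh x)) = J₂ at h ⊢
  field_simp
  linarith

lemma integral_id_mul_exp_neg_sub_mul_cosh (ν t : ℝ) :
    ∫ x : ℝ, x * exp (-(ν * x) - t * cosh x) = -∫ x : ℝ, x * exp (ν * x - t * cosh x) := by
  rw [← integral_neg_eq_self, ← integral_neg]
  simp

end IntegralRecurrence

section SumRecurrence

/-- If `u (k + 2) = z ^ 2 * u k + (k + 1) * u (k + 1)`, the sums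
`∑ k < m, m! / (k! * (m - k)) * u k` satisfy an inhomogeneous three-term recurrence. -/
lemma sum_factorial_div_recurrence (u : ℕ → ℝ) (z : ℝ)
    (hu : ∀ k : ℕ, u (k + 2) = z ^ 2 * u k + (k + 1) * u (k + 1)) (n : ℕ) :
    (n + 2).factorial * ∑ k ∈ Finset.range (n + 2),
        u k / ((k.factorial : ℝ) * (((n + 2 : ℕ) : ℝ) - k))
      = z ^ 2 * (n.factorial * ∑ k ∈ Finset.range n, u k / ((k.factorial : ℝ) * ((n : ℝ) - k)))
        + (n + 1) * ((n + 1).factorial * ∑ k ∈ Finset.range (n + 1),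
          u k / ((k.factorial : ℝ) * (((n + 1 : ℕ) : ℝ) - k)))
        + 2 * u (n + 1) := by
  have htelescope := Finset.sum_range_sub
    (fun k : ℕ => (n.factorial : ℝ) / (k + 1).factorial * (n + k + 2) * u (k + 1)) n
  have hterm : ∀ k ∈ Finset.range n,
      (n.factorial : ℝ) / (k + 1 + 1).factorial * (n + (k + 1 : ℕ) + 2) * u (k + 1 + 1)
          - n.factorial / (k + 1).factorial * (n + k + 2) * u (k + 1)
        = (n + 2).factorial
            * (u (k + 1 + 1) / (((k + 1 + 1).factorial : ℝ)
              * (((n + 2 : ℕ) : ℝ) - (k + 1 + 1 : ℕ))))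
          - z ^ 2 * (n.factorial * (u k / ((k.factorial : ℝ) * ((n : ℝ) - k))))
          - (n + 1) * ((n + 1).factorial
            * (u (k + 1) / (((k + 1).factorial : ℝ)
              * (((n + 1 : ℕ) : ℝ) - (k + 1 : ℕ))))) := by
    intro k hk
    have hkn : (n : ℝ) - k ≠ 0 :=
      sub_ne_zero.mpr (by exact_mod_cast (Finset.mem_range.mp hk).ne')
    have h₁ : ((n + 2 : ℕ) : ℝ) - (k + 1 + 1 : ℕ) = n - k := by push_cast; ring
    have h₂ : ((n + 1 : ℕ) : ℝ) - (k + 1 : ℕ) = n - k := by push_cast; ring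
    have hz : u (k + 1 + 1) = z ^ 2 * u k + (k + 1) * u (k + 1) := hu k
    rw [h₁, h₂, hz]
    have hfac : (k.factorial : ℝ) ≠ 0 := by exact_mod_cast k.factorial_ne_zero
    simp only [Nat.factorial_succ]
    push_cast
    field_simp
    ring
  rw [Finset.sum_congr rfl hterm, Finset.sum_sub_distrib, Finset.sum_sub_distrib] at htelescope
  simp only [← Finset.mul_sum] at htelescope
  rw [Finset.sum_range_succ' _ (n + 1), Finset.sum_range_succ' _ n, Finset.sum_range_succ' _ n]
  have hfac : (n.factorial : ℝ) ≠ 0 := by exact_mod_cast n.factorial_ne_zero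
  have hlast : (n.factorial : ℝ) / (n + 1).factorial * (n + n + 2) * u (n + 1)
      = 2 * u (n + 1) := by
    rw [Nat.factorial_succ]
    push_cast
    field_simp
    ring
  have hzero : ((n + 2).factorial : ℝ) * (u 0 / ((Nat.factorial 0 : ℝ)
        * (((n + 2 : ℕ) : ℝ) - (0 : ℕ))))
      = (n + 1) * ((n + 1).factorial * (u 0 / ((Nat.factorial 0 : ℝ)
        * (((n + 1 : ℕ) : ℝ) - (0 : ℕ))))) := by
    have h : (n : ℝ) + 2 ≠ 0 := by positivity
    simp only [Nat.factorial_succ, Nat.factorial_zero]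
    push_cast
    simp only [sub_zero]
    field_simp
    ring
  have hone : ((n + 2).factorial : ℝ) * (u (0 + 1) / (((0 + 1).factorial : ℝ)
        * (((n + 2 : ℕ) : ℝ) - (0 + 1 : ℕ))))
      = n.factorial / (0 + 1).factorial * (n + (0 : ℕ) + 2) * u (0 + 1) := by
    have h : (n : ℝ) + 2 - 1 = n + 1 := by ring
    simp only [Nat.factorial_succ, Nat.factorial_zero]
    push_cast
    simp only [h]
    field_simp
    ring
  linarith

end SumRecurrence

lemma pow_mul_integral_id_mul_exp_sub_mul_cosh {t : ℝ} (ht : 0 < t) (m : ℕ) :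
    (t / 2) ^ m * ∫ x : ℝ, x * exp ((m : ℝ) * x - t * cosh x)
      = m.factorial * ∑ k ∈ Finset.range m,
        (t / 2) ^ k * besselK k t / ((k.factorial : ℝ) * ((m : ℝ) - k)) := by
  have hz : t / 2 ≠ 0 := by positivity
  induction m using Nat.twoStepInduction with
  | zero =>
    have h := integral_id_mul_exp_neg_sub_mul_cosh 0 t
    simp only [zero_mul, neg_zero] at h
    simp only [Nat.cast_zero, zero_mul, Finset.range_zero, Finset.sum_empty, mul_zero, pow_zero]
    linarith
  | one =>
    have h := integral_id_mul_exp_sub_mul_cosh_add_one ht 0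
    have hneg := integral_id_mul_exp_neg_sub_mul_cosh 1 t
    simp only [one_mul] at hneg
    simp only [zero_add, zero_sub, neg_mul, one_mul, zero_div, zero_mul, add_zero, hneg] at h
    simp only [Nat.cast_one, one_mul, pow_one, Nat.factorial_one, Finset.range_one,
      Finset.sum_singleton, pow_zero, Nat.factorial_zero, Nat.cast_zero, sub_zero, div_one]
    field_simp at h ⊢
    linarith
  | more n ihn ihn1 =>
    have hu (k : ℕ) : (t / 2) ^ (k + 2) * besselK (k + 2 : ℕ) t
        = (t / 2) ^ 2 * ((t / 2) ^ k * besselK k t)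
          + (k + 1) * ((t / 2) ^ (k + 1) * besselK (k + 1 : ℕ) t) := by
      have h := besselK_add_one ht ((k : ℝ) + 1)
      rw [add_sub_cancel_right, add_assoc, one_add_one_eq_two] at h
      push_cast
      rw [h]
      generalize t / 2 = z at hz ⊢
      field_simp
      ring
    rw [sum_factorial_div_recurrence _ _ hu, ← ihn, ← ihn1]
    have h := integral_id_mul_exp_sub_mul_cosh_add_one ht ((n : ℝ) + 1)
    rw [add_sub_cancel_right, add_assoc, one_add_one_eq_two] at h
    push_cast
    rw [h]
    generalize (∫ x : ℝ, x * exp ((n : ℝ) * x - t * cosh x)) = J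
    generalize t / 2 = z at hz ⊢
    field_simp
    ring

theorem integral_x_exp_cosh (t : ℝ) (ht : 0 < t) (m : ℕ) (hm : 1 ≤ m) :
    (∫ x : ℝ, x * Real.exp ((m : ℝ) * x - t * Real.cosh x))
        = (m.factorial : ℝ) *
            ∑ k ∈ Finset.range m,
              besselK k t / ((k.factorial : ℝ) * ((m : ℝ) - k)) * (t / 2) ^ ((k : ℤ) - (m : ℤ))
      ∧ (∫ x : ℝ, x * Real.exp (-((m : ℝ) * x) - t * Real.cosh x))
          = -((m.factorial : ℝ) *
              ∑ k ∈ Finset.range m,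
                besselK k t / ((k.factorial : ℝ) * ((m : ℝ) - k)) * (t / 2) ^ ((k : ℤ) - (m : ℤ))) := by
  have hz : t / 2 ≠ 0 := by positivity
  have hpos : (∫ x : ℝ, x * Real.exp ((m : ℝ) * x - t * Real.cosh x))
      = (m.factorial : ℝ) * ∑ k ∈ Finset.range m,
        besselK k t / ((k.factorial : ℝ) * ((m : ℝ) - k)) * (t / 2) ^ ((k : ℤ) - (m : ℤ)) := by
    apply mul_left_cancel₀ (pow_ne_zero m hz)
    rw [pow_mul_integral_id_mul_exp_sub_mul_cosh ht m, mul_left_comm,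
      Finset.mul_sum _ _ ((t / 2) ^ m)]
    refine congrArg _ (Finset.sum_congr rfl fun k _ => ?_)
    rw [zpow_sub₀ hz, zpow_natCast, zpow_natCast]
    field_simp
  exact ⟨hpos, by rw [integral_id_mul_exp_neg_sub_mul_cosh, hpos]⟩
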